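/- The Allen relation A {before, before_inverse} B is not pointisable on the four endpoints: there do not exist sets R(i, j) ⊆ {<, =, >} of basic point relations, one for each ordered pair of distinct points among {A⁻, A⁺, B⁻, B⁺}, such that for every assignment of real numbers to A⁻, A⁺, B⁻, B⁺ with A⁻ < A⁺ and B⁻ < B⁺, the assignment satisfies all the point-algebra constraints (i.e., for each pair (i, j) the order relation holding between the values of i and j belongs to R(i, j)) if and only if A⁺ < B⁻ or B⁺ < A⁻. -/

import Mathlib

/-- The four endpoints of the intervals `A` and `B`: the start and end points
`A⁻, A⁺, B⁻, B⁺`. -/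
inductive Pt
  | Am | Ap | Bm | Bp
deriving DecidableEq

/-- The assignment of real numbers to the four endpoints with the given values. -/
def Pt.assign (a b c d : ℝ) : Pt → ℝ
  | .Am => a
  | .Ap => b
  | .Bm => c
  | .Bp => d

/-- Every pairwise order in an overlapping configuration already occurs in a configuration with
`A` before `B` or in one with `A` after `B`. -/
theorem Pt.compare_overlap (i j : Pt) (hij : i ≠ j) :
    compare (assign 0 2 1 3 i) (assign 0 2 1 3 j) =
        compare (assign 0 1 2 3 i) (assign 0 1 2 3 j) ∨
      compare (assign 0 2 1 3 i) (assign 0 2 1 3 j) =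
        compare (assign 2 3 0 1 i) (assign 2 3 0 1 j) := by
  have hlt {x y : ℝ} (h : x < y) : compare x y = .lt := compare_lt_iff_lt.2 h
  have hgt {x y : ℝ} (h : y < x) : compare x y = .gt := compare_gt_iff_gt.2 h
  cases i <;> cases j <;> first
    | exact absurd rfl hij
    | norm_num [assign, hlt, hgt]

/-- The Allen relation `A {before, before_inverse} B` is not pointisable:
there is no assignment of subsets of the basic point relations `{<, =, >}`
(encoded as `Ordering`s) to ordered pairs of distinct endpoints such that,
for every real assignment to the endpoints with `A⁻ < A⁺` and `B⁻ < B⁺`,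
all the point constraints are satisfied iff `A⁺ < B⁻` or `B⁺ < A⁻`. -/
theorem before_or_after_not_pointisable :
    ¬ ∃ R : Pt → Pt → Set Ordering,
      ∀ g : Pt → ℝ, g Pt.Am < g Pt.Ap → g Pt.Bm < g Pt.Bp →
        ((∀ i j, i ≠ j → compare (g i) (g j) ∈ R i j) ↔
          (g Pt.Ap < g Pt.Bm ∨ g Pt.Bp < g Pt.Am)) := by
  rintro ⟨R, hR⟩
  have before := (hR (Pt.assign 0 1 2 3) (by norm_num [Pt.assign])
    (by norm_num [Pt.assign])).2 (by norm_num [Pt.assign])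
  have after := (hR (Pt.assign 2 3 0 1) (by norm_num [Pt.assign])
    (by norm_num [Pt.assign])).2 (by norm_num [Pt.assign])
  have overlap := (hR (Pt.assign 0 2 1 3) (by norm_num [Pt.assign])
    (by norm_num [Pt.assign])).1 fun i j hij => by
      rcases Pt.compare_overlap i j hij with h | h <;> rw [h]
      · exact before i j hij
      · exact after i j hij
  norm_num [Pt.assign] at overlap
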